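/- Fix k ∈ ℕ with k ≥ 1 and let n₁, n₂ ∈ ℝ with n₁ ≥ 0, n₂ ≥ 0 and n₁ + n₂ = 1. For θ = (θ₁,θ₂) ∈ ℝ² define w_θ : Fin 2 → ℂ by w_θ(0) = √n₁·exp(−i θ₁) and w_θ(1) = √n₂·exp(−i θ₂). Then for all σ, τ : Fin k → Fin 2, (1/(2π)²) · ∫_{[0,2π]} ∫_{[0,2π]} ( ∏_{i=0}^{k−1} w_θ(σ(i)) ) · ( ∏_{i=0}^{k−1} conj(w_θ(τ(i))) ) dθ₁ dθ₂ = Σ_{j=0}^{k} binom(k,j) · n₁^{k−j} · n₂^{j} · v_{k,j}(σ) · conj(v_{k,j}(τ)). -/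

import Mathlib

open scoped BigOperators Real
open ComplexConjugate

noncomputable section

/-- Number of indices `i` with `σ i = 1`. -/
def cnt {m : ℕ} (σ : Fin m → Fin 2) : ℕ :=
  (Finset.univ.filter fun i => σ i = 1).card

/-- Coordinate vector of the normalized symmetric tensor `e₁^{⊗(k−j)} ∨ e₂^{⊗j}`. -/
def vkj (k j : ℕ) (σ : Fin k → Fin 2) : ℂ :=
  if cnt σ = j then (((Real.sqrt (Nat.choose k j))⁻¹ : ℝ) : ℂ) else 0

/-- The one-body vector `w_θ(0) = √n₁ e^{−iθ₁}`, `w_θ(1) = √n₂ e^{−iθ₂}`. -/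
def w (n₁ n₂ θ₁ θ₂ : ℝ) : Fin 2 → ℂ :=
  fun i => if i = 0 then (Real.sqrt n₁ : ℂ) * Complex.exp (-(Complex.I * (θ₁ : ℂ)))
    else (Real.sqrt n₂ : ℂ) * Complex.exp (-(Complex.I * (θ₂ : ℂ)))

theorem cnt_le {k : ℕ} (σ : Fin k → Fin 2) : cnt σ ≤ k :=
  (Finset.card_filter_le _ _).trans_eq (by simp)

theorem prod_comp_eq_pow_cnt {M : Type*} [CommMonoid M] {k : ℕ} (f : Fin 2 → M)
    (σ : Fin k → Fin 2) :
    ∏ i, f (σ i) = f 0 ^ (k - cnt σ) * f 1 ^ cnt σ := by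
  have hcard := Finset.card_filter_add_card_filter_not (s := (Finset.univ : Finset (Fin k)))
    (fun i => σ i = 1)
  rw [Finset.card_univ, Fintype.card_fin] at hcard
  have hzero : (Finset.univ.filter fun i => ¬ σ i = 1).card = k - cnt σ := by
    unfold cnt; omega
  rw [← Finset.prod_filter_mul_prod_filter_not Finset.univ (fun i => σ i = 1), mul_comm]
  congr 1
  · rw [← hzero]
    refine Finset.prod_eq_pow_card fun i hi => ?_
    have hi := (Finset.mem_filter.mp hi).2
    rw [show σ i = 0 by omega]
  · exact Finset.prod_eq_pow_card fun i hi => by rw [(Finset.mem_filter.mp hi).2]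

theorem integral_phase_pow_mul_conj_pow (p q : ℕ) :
    ∫ θ in (0 : ℝ)..(2 * π),
        Complex.exp (-(Complex.I * (θ : ℂ))) ^ p * conj (Complex.exp (-(Complex.I * (θ : ℂ)))) ^ q
      = if p = q then (2 * π : ℂ) else 0 := by
  have hexp (θ : ℝ) :
      Complex.exp (-(Complex.I * (θ : ℂ))) ^ p * conj (Complex.exp (-(Complex.I * (θ : ℂ)))) ^ q
        = Complex.exp (((q : ℂ) - p) * Complex.I * θ) := by
    rw [← Complex.exp_conj, ← Complex.exp_nat_mul, ← Complex.exp_nat_mul, ← Complex.exp_add]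
    congr 1
    simp only [map_neg, map_mul, Complex.conj_I, Complex.conj_ofReal]
    ring
  simp_rw [hexp]
  split_ifs with h
  · simp [h]
  · have hne : ((q : ℂ) - p) * Complex.I ≠ 0 :=
      mul_ne_zero (sub_ne_zero.mpr fun e => h (Nat.cast_injective e).symm) Complex.I_ne_zero
    have hperiod : Complex.exp (((q : ℂ) - p) * Complex.I * ((2 * π : ℝ) : ℂ)) = 1 :=
      Complex.exp_eq_one_iff.mpr ⟨(q : ℤ) - p, by push_cast; ring⟩
    rw [integral_exp_mul_complex hne, hperiod]
    simp

theorem choose_mul_vkj_mul_conj_vkj {k j : ℕ} (hj : j ≤ k) (σ τ : Fin k → Fin 2) :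
    (k.choose j : ℂ) * (vkj k j σ * conj (vkj k j τ))
      = if cnt σ = j ∧ cnt τ = j then 1 else 0 := by
  have hpos : (0 : ℝ) < k.choose j := by exact_mod_cast Nat.choose_pos hj
  have hnorm : (k.choose j : ℝ) * ((√(k.choose j : ℝ))⁻¹ * (√(k.choose j : ℝ))⁻¹) = 1 := by
    rw [← mul_inv, Real.mul_self_sqrt hpos.le, mul_inv_cancel₀ hpos.ne']
  unfold vkj
  by_cases hσ : cnt σ = j <;> by_cases hτ : cnt τ = j <;> simp only [hσ, hτ, if_true, if_false,
    and_true, and_false, map_zero, mul_zero, zero_mul, Complex.conj_ofReal]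
  exact_mod_cast hnorm

/-- phase averaging of the simple condensate
`(√n₁ e^{−iθ₁} e₁ + √n₂ e^{−iθ₂} e₂)^{⊗k}` produces the binomial mixture of
symmetric tensors, entrywise in the product basis of `(ℂ²)^{⊗k}`. -/
theorem stmt7 (k : ℕ) (hk : 1 ≤ k) (n₁ n₂ : ℝ) (h₁ : 0 ≤ n₁) (h₂ : 0 ≤ n₂)
    (hsum : n₁ + n₂ = 1) (σ τ : Fin k → Fin 2) :
    (1 / (2 * π) ^ 2 : ℂ) *
        ∫ θ₁ in (0 : ℝ)..(2 * π), ∫ θ₂ in (0 : ℝ)..(2 * π),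
          (∏ i, w n₁ n₂ θ₁ θ₂ (σ i)) * ∏ i, conj (w n₁ n₂ θ₁ θ₂ (τ i))
      = ∑ j ∈ Finset.range (k + 1),
          (k.choose j : ℂ) * (n₁ : ℂ) ^ (k - j) * (n₂ : ℂ) ^ j
            * vkj k j σ * conj (vkj k j τ) := by
  have hprod (θ₁ θ₂ : ℝ) :
      (∏ i, w n₁ n₂ θ₁ θ₂ (σ i)) * ∏ i, conj (w n₁ n₂ θ₁ θ₂ (τ i))
        = ((√n₁ : ℂ) ^ (k - cnt σ + (k - cnt τ)) * (√n₂ : ℂ) ^ (cnt σ + cnt τ)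
          * (Complex.exp (-(Complex.I * (θ₁ : ℂ))) ^ (k - cnt σ)
            * conj (Complex.exp (-(Complex.I * (θ₁ : ℂ)))) ^ (k - cnt τ)))
          * (Complex.exp (-(Complex.I * (θ₂ : ℂ))) ^ cnt σ
            * conj (Complex.exp (-(Complex.I * (θ₂ : ℂ)))) ^ cnt τ) := by
    rw [prod_comp_eq_pow_cnt, prod_comp_eq_pow_cnt (fun x => conj (w n₁ n₂ θ₁ θ₂ x))]
    simp only [w, if_true, one_ne_zero, if_false, map_mul, Complex.conj_ofReal]
    ring
  have hsummand : ∀ j ∈ Finset.range (k + 1),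
      (k.choose j : ℂ) * (n₁ : ℂ) ^ (k - j) * (n₂ : ℂ) ^ j * vkj k j σ * conj (vkj k j τ)
        = if cnt σ = j then
            if cnt τ = j then (n₁ : ℂ) ^ (k - j) * (n₂ : ℂ) ^ j else 0
          else 0 := by
    intro j hj
    calc _ = (n₁ : ℂ) ^ (k - j) * (n₂ : ℂ) ^ j
          * ((k.choose j : ℂ) * (vkj k j σ * conj (vkj k j τ))) := by ring
      _ = _ := by
        rw [choose_mul_vkj_mul_conj_vkj (Finset.mem_range_succ_iff.mp hj), mul_ite, mul_one,
          mul_zero, ite_and]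
  rw [Finset.sum_congr rfl hsummand, Finset.sum_ite_eq,
    if_pos (Finset.mem_range_succ_iff.mpr (cnt_le σ))]
  simp_rw [hprod, intervalIntegral.integral_const_mul, integral_phase_pow_mul_conj_pow,
    intervalIntegral.integral_mul_const, intervalIntegral.integral_const_mul,
    integral_phase_pow_mul_conj_pow]
  by_cases h : cnt σ = cnt τ
  · have hs₁ : (√n₁ : ℂ) * √n₁ = n₁ := by exact_mod_cast Real.mul_self_sqrt h₁
    have hs₂ : (√n₂ : ℂ) * √n₂ = n₂ := by exact_mod_cast Real.mul_self_sqrt h₂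
    have hπ : (π : ℂ) ≠ 0 := by exact_mod_cast Real.pi_ne_zero
    simp only [h, if_true]
    rw [pow_add, pow_add, ← mul_pow, ← mul_pow, hs₁, hs₂]
    field_simp
  · simp [h, Ne.symm h]

end
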